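/- For a commutative semigroup X the following conditions are equivalent: (1) X is absolutely T₁S-closed; (2) X is projectively T₁S-closed and projectively T₁S-discrete; (3) X is projectively TzS-closed and projectively TzS-discrete; (4) X is finite. -/

import Mathlib

universe u

open Set TopologicalSpace

/-- A topological space is zero-dimensional: it has a base of clopen sets. -/
def HasClopenBasis (Y : Type*) [TopologicalSpace Y] : Prop :=
  ∃ B : Set (Set Y), (∀ s ∈ B, IsClopen s) ∧ IsTopologicalBasis B

section TopClasses

variable (X : Type u) [Semigroup X]

/-- `X` is absolutely `T₁S`-closed: the image of every homomorphism to a `T₁`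
topological semigroup is closed. -/
def AbsolutelyT1SClosed : Prop :=
  ∀ (Y : Type u) [Semigroup Y] [TopologicalSpace Y] [ContinuousMul Y] [T1Space Y]
    (h : X →ₙ* Y), IsClosed (Set.range h)

/-- `X` is absolutely `T₂S`-closed. -/
def AbsolutelyT2SClosed : Prop :=
  ∀ (Y : Type u) [Semigroup Y] [TopologicalSpace Y] [ContinuousMul Y] [T2Space Y]
    (h : X →ₙ* Y), IsClosed (Set.range h)

/-- `X` is absolutely `TzS`-closed. -/
def AbsolutelyTzSClosed : Prop :=
  ∀ (Y : Type u) [Semigroup Y] [TopologicalSpace Y] [ContinuousMul Y] [T1Space Y],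
    HasClopenBasis Y → ∀ (h : X →ₙ* Y), IsClosed (Set.range h)

/-- `X` is `T₁S`-closed: the image of every injective homomorphism to a `T₁`
topological semigroup with discrete image is closed. -/
def T1SClosed : Prop :=
  ∀ (Y : Type u) [Semigroup Y] [TopologicalSpace Y] [ContinuousMul Y] [T1Space Y]
    (h : X →ₙ* Y), Function.Injective h → DiscreteTopology (Set.range h) →
      IsClosed (Set.range h)

/-- `X` is `T₂S`-closed. -/
def T2SClosed : Prop :=
  ∀ (Y : Type u) [Semigroup Y] [TopologicalSpace Y] [ContinuousMul Y] [T2Space Y]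
    (h : X →ₙ* Y), Function.Injective h → DiscreteTopology (Set.range h) →
      IsClosed (Set.range h)

/-- `X` is `TzS`-closed. -/
def TzSClosed : Prop :=
  ∀ (Y : Type u) [Semigroup Y] [TopologicalSpace Y] [ContinuousMul Y] [T1Space Y],
    HasClopenBasis Y → ∀ (h : X →ₙ* Y), Function.Injective h →
      DiscreteTopology (Set.range h) → IsClosed (Set.range h)

/-- `X` is injectively `T₂S`-closed. -/
def InjectivelyT2SClosed : Prop :=
  ∀ (Y : Type u) [Semigroup Y] [TopologicalSpace Y] [ContinuousMul Y] [T2Space Y]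
    (h : X →ₙ* Y), Function.Injective h → IsClosed (Set.range h)

/-- `X` is projectively `T₁S`-closed: all congruence quotients are `T₁S`-closed. -/
def ProjectivelyT1SClosed : Prop := ∀ c : Con X, T1SClosed c.Quotient

/-- `X` is projectively `TzS`-closed. -/
def ProjectivelyTzSClosed : Prop := ∀ c : Con X, TzSClosed c.Quotient

/-- `X` is projectively `T₁S`-discrete: every homomorphism into a `T₁`
topological semigroup has discrete image. -/
def ProjectivelyT1SDiscrete : Prop :=
  ∀ (Y : Type u) [Semigroup Y] [TopologicalSpace Y] [ContinuousMul Y] [T1Space Y]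
    (h : X →ₙ* Y), DiscreteTopology (Set.range h)

/-- `X` is projectively `TzS`-discrete. -/
def ProjectivelyTzSDiscrete : Prop :=
  ∀ (Y : Type u) [Semigroup Y] [TopologicalSpace Y] [ContinuousMul Y] [T1Space Y],
    HasClopenBasis Y → ∀ (h : X →ₙ* Y), DiscreteTopology (Set.range h)

end TopClasses

/-- `spow x n` is the power `x^(n+1)` in a semigroup; thus as `n` ranges over `ℕ`,
`spow x n` ranges over all powers `x^m`, `m ≥ 1`. -/
def spow {X : Type*} [Semigroup X] (x : X) : ℕ → X
  | 0 => x
  | n + 1 => spow x n * x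

section AlgDefs

variable (X : Type*) [Semigroup X]

/-- the set `E(X)` of idempotents. -/
def idemSet : Set X := {x | x * x = x}

/-- `H_e`, the maximal subgroup containing the idempotent `e`. -/
def maxSubgroup (e : X) : Set X :=
  {x | x * e = x ∧ e * x = x ∧ ∃ y, y * e = y ∧ e * y = y ∧ x * y = e ∧ y * x = e}

/-- The Clifford part `H(X) = ⋃_{e ∈ E(X)} H_e`. -/
def cliffordPart : Set X := ⋃ e ∈ idemSet X, maxSubgroup X e

/-- `H_e/e := {x : xe = ex ∈ H_e}`. -/
def HeCoideal (e : X) : Set X := {x | x * e = e * x ∧ x * e ∈ maxSubgroup X e}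

/-- `I` is an ideal of the semigroup `X`. -/
def IsIdealSet (I : Set X) : Prop := ∀ x ∈ I, ∀ y : X, x * y ∈ I ∧ y * x ∈ I

/-- The set `VE(X)` of viable idempotents: `e` is idempotent and `X ∖ (H_e/e)` is an ideal. -/
def viableIdems : Set X := {e | e ∈ idemSet X ∧ IsIdealSet X (Set.univ \ HeCoideal X e)}

/-- The center `Z(X)`. -/
def centerSet : Set X := {z | ∀ x, z * x = x * z}

/-- `√A = {x : xⁿ ∈ A for some n ≥ 1}`. -/
def sqrtSet (A : Set X) : Set X := {x | ∃ n : ℕ, spow x n ∈ A}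

/-- A subset `B ⊆ X` is bounded: there is `n ≥ 1` with `xⁿ` idempotent for all `x ∈ B`. -/
def BoundedSet (B : Set X) : Prop := ∃ n : ℕ, ∀ x ∈ B, spow x n ∈ idemSet X

/-- The semigroup `X` is bounded. -/
def BoundedSemigroup : Prop := ∃ n : ℕ, ∀ x : X, spow x n ∈ idemSet X

/-- `X` is chain-finite. -/
def ChainFinite : Prop :=
  ∀ I : Set X, I.Infinite → ∃ x ∈ I, ∃ y ∈ I, x * y ≠ x ∧ x * y ≠ y

/-- `G ⊆ X` is a subgroup of the semigroup `X`. -/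
def IsSubgroupSet (G : Set X) : Prop :=
  (∀ x ∈ G, ∀ y ∈ G, x * y ∈ G) ∧
    ∃ e ∈ G, (∀ x ∈ G, x * e = x ∧ e * x = x) ∧ ∀ x ∈ G, ∃ y ∈ G, x * y = e ∧ y * x = e

/-- `X` is group-finite: all its subgroups are finite. -/
def GroupFinite : Prop := ∀ G : Set X, IsSubgroupSet X G → G.Finite

/-- `X` is Clifford+finite: `X ∖ H(X)` is finite. -/
def CliffordPlusFinite : Prop := (Set.univ \ cliffordPart X).Finite

/-- `X` is `E`-commutative: idempotents commute. -/
def ECommutative : Prop := ∀ x ∈ idemSet X, ∀ y ∈ idemSet X, x * y = y * x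

end AlgDefs

/-- The Rees congruence associated with an ideal `I` of `X`. -/
def ReesCon {X : Type*} [Semigroup X] (I : Set X) (hI : IsIdealSet X I) : Con X where
  r x y := x = y ∨ (x ∈ I ∧ y ∈ I)
  iseqv :=
    { refl := fun _ => Or.inl rfl
      symm := by rintro x y (rfl | ⟨h1, h2⟩); exacts [Or.inl rfl, Or.inr ⟨h2, h1⟩]
      trans := by
        rintro x y z (rfl | ⟨h1, h2⟩) (rfl | ⟨h3, h4⟩)
        exacts [Or.inl rfl, Or.inr ⟨h3, h4⟩, Or.inr ⟨h1, h2⟩, Or.inr ⟨h1, h4⟩] }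
  mul' := by
    rintro a b c d (rfl | ⟨h1, h2⟩) (rfl | ⟨h3, h4⟩)
    · exact Or.inl rfl
    · exact Or.inr ⟨(hI c h3 a).2, (hI d h4 a).2⟩
    · exact Or.inr ⟨(hI a h1 c).1, (hI b h2 c).1⟩
    · exact Or.inr ⟨(hI a h1 c).1, (hI b h2 d).1⟩

/-- `X` is ideally `T₂S`-closed: all its Rees quotients are `T₂S`-closed. -/
def IdeallyT2SClosed (X : Type u) [Semigroup X] : Prop :=
  ∀ (I : Set X) (hI : IsIdealSet X I), T2SClosed (ReesCon I hI).Quotient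

/-- `X` is ideally `TzS`-closed. -/
def IdeallyTzSClosed (X : Type u) [Semigroup X] : Prop :=
  ∀ (I : Set X) (hI : IsIdealSet X I), TzSClosed (ReesCon I hI).Quotient

/-- A congruence is a semilattice congruence if its quotient is a commutative
semigroup of idempotents. -/
def IsSemilatticeCon {X : Type*} [Semigroup X] (c : Con X) : Prop :=
  (∀ a b : c.Quotient, a * b = b * a) ∧ ∀ a : c.Quotient, a * a = a

/-- The smallest semilattice congruence `⇕` on `X`, the intersection of all
semilattice congruences. -/
def slCon (X : Type*) [Semigroup X] : Con X := sInf {c | IsSemilatticeCon c}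

theorem centerSet_mul_mem {X : Type*} [Semigroup X] {a b : X}
    (ha : a ∈ centerSet X) (hb : b ∈ centerSet X) : a * b ∈ centerSet X := fun t => by
  rw [mul_assoc, hb t, ← mul_assoc, ha t, mul_assoc]

/-- The ideal center `IZ(X) = {z ∈ Z(X) : zX ⊆ Z(X)}`, as a subsemigroup of `X`. -/
def idealCenter (X : Type*) [Semigroup X] : Subsemigroup X where
  carrier := {z | z ∈ centerSet X ∧ ∀ x : X, z * x ∈ centerSet X}
  mul_mem' := by
    rintro a b ⟨ha, ha'⟩ ⟨hb, hb'⟩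
    refine ⟨centerSet_mul_mem ha hb, fun x => ?_⟩
    have h : a * b * x = a * (b * x) := mul_assoc a b x
    rw [h]
    exact centerSet_mul_mem ha (hb' x)

/-- Evaluation of the semigroup polynomial with coefficients `a, l = [a₁, …, aₙ]`:
`x ↦ a * x * a₁ * x * ⋯ * x * aₙ` (computed in `X¹ = WithOne X`). -/
def polyEval {X : Type*} [Semigroup X] (a : WithOne X) (l : List (WithOne X)) (x : X) :
    WithOne X :=
  l.foldl (fun acc b => acc * (x : WithOne X) * b) a

/-- `f : X → X¹` is a semigroup polynomial of degree `d ≥ 1`. -/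
def IsSemigroupPolynomial {X : Type*} [Semigroup X] (f : X → WithOne X) (d : ℕ) : Prop :=
  1 ≤ d ∧ ∃ (a : WithOne X) (l : List (WithOne X)), l.length = d ∧ ∀ x, f x = polyEval a l x

/-- `X` is polybounded. -/
def Polybounded (X : Type*) [Semigroup X] : Prop :=
  ∃ (k : ℕ) (f : Fin k → X → WithOne X) (d : Fin k → ℕ) (b : Fin k → X),
    (∀ i, IsSemigroupPolynomial (f i) (d i)) ∧ ∀ x : X, ∃ i, f i x = (b i : WithOne X)

/-- `X` is polyfinite. -/
def Polyfinite (X : Type*) [Semigroup X] : Prop :=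
  ∃ (d : ℕ) (F : Set X), F.Finite ∧ ∀ x y : X,
    ∃ (f : X → WithOne X) (m : ℕ), m ≤ d ∧ IsSemigroupPolynomial f m ∧
      (∃ u ∈ F, f x = (u : WithOne X)) ∧ ∃ v ∈ F, f y = (v : WithOne X)

/-- `X` is `B`-centrobounded over `B ⊆ E(X)`: there is `n ≥ 1` such that for every
`e ∈ B` and all `x, y ∈ ⋂_{a ∈ B} H_a/a`, if `w` is the inverse of `y*e` in the group
`H_e` and `(x*e)*w ∈ H_e ∩ Z(X)`, then `((x*e)*w)ⁿ` is an idempotent. -/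
def Centrobounded {X : Type*} [Semigroup X] (B : Set X) : Prop :=
  ∃ n : ℕ, ∀ e ∈ B, ∀ x ∈ ⋂ a ∈ B, HeCoideal X a, ∀ y ∈ ⋂ a ∈ B, HeCoideal X a,
    ∀ w ∈ maxSubgroup X e, (y * e) * w = e → w * (y * e) = e →
      (x * e) * w ∈ maxSubgroup X e → (x * e) * w ∈ centerSet X →
        spow ((x * e) * w) n ∈ idemSet X

/-- `B` is an antichain in the natural partial order `e ≤ f ⇔ ef = fe = e` on idempotents. -/
def IsIdemAntichain {X : Type*} [Semigroup X] (B : Set X) : Prop :=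
  ∀ e ∈ B, ∀ f ∈ B, e ≠ f → ¬(e * f = e ∧ f * e = e) ∧ ¬(e * f = f ∧ f * e = f)

open Filter Topology

/-- Every homomorphism from `M` to a zero-dimensional topological semigroup has closed
discrete image. -/
def ClosedDiscreteImages (M : Type u) [Semigroup M] : Prop :=
  ∀ (Y : Type u) [Semigroup Y] [TopologicalSpace Y] [ContinuousMul Y] [T1Space Y],
    HasClopenBasis Y → ∀ h : M →ₙ* Y, IsClosed (Set.range h) ∧ IsDiscrete (Set.range h)

theorem HasClopenBasis.of_forall_exists {Y : Type*} [TopologicalSpace Y]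
    (H : ∀ (y : Y) (U : Set Y), y ∈ U → IsOpen U → ∃ V, IsClopen V ∧ y ∈ V ∧ V ⊆ U) :
    HasClopenBasis Y :=
  ⟨{V | IsClopen V}, fun _ h => h, isTopologicalBasis_of_isOpen_of_nhds
    (fun _ h => h.isOpen) fun y U hy hU => H y U hy hU⟩

theorem HasClopenBasis.exists_isClopen {Y : Type*} [TopologicalSpace Y] (hY : HasClopenBasis Y)
    {y : Y} {U : Set Y} (hy : y ∈ U) (hU : IsOpen U) : ∃ V, IsClopen V ∧ y ∈ V ∧ V ⊆ U := by
  obtain ⟨B, hB, hb⟩ := hY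
  obtain ⟨V, hV, hyV, hVU⟩ := hb.exists_subset_of_mem_open hy hU
  exact ⟨V, hB V hV, hyV, hVU⟩

theorem HasClopenBasis.of_isInducing {Y Z : Type*} [TopologicalSpace Y] [TopologicalSpace Z]
    {f : Y → Z} (hf : IsInducing f) (hZ : HasClopenBasis Z) : HasClopenBasis Y := by
  refine .of_forall_exists fun y U hy hU => ?_
  obtain ⟨W, hW, rfl⟩ := hf.isOpen_iff.1 hU
  obtain ⟨V, hV, hyV, hVW⟩ := hZ.exists_isClopen hy hW
  exact ⟨f ⁻¹' V, hV.preimage hf.continuous, hyV, preimage_mono hVW⟩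

theorem HasClopenBasis.of_profinite (Y : Type*) [TopologicalSpace Y] [T2Space Y]
    [CompactSpace Y] [TotallyDisconnectedSpace Y] : HasClopenBasis Y :=
  ⟨_, fun _ h => h, isTopologicalBasis_isClopen⟩

theorem HasClopenBasis.of_countable_metric (Y : Type*) [MetricSpace Y] [Countable Y] :
    HasClopenBasis Y := by
  refine .of_forall_exists fun y U hy hU => ?_
  obtain ⟨ε, hε, hεU⟩ := Metric.isOpen_iff.1 hU y hy
  have hc : (Set.range fun z => dist z y).Countable := countable_range _
  obtain ⟨r, hr, hr'⟩ : ((Ioo 0 ε) \ Set.range fun z => dist z y).Nonempty := by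
    by_contra hne
    rw [Set.not_nonempty_iff_eq_empty, sdiff_eq_empty] at hne
    exact (Cardinal.Real.Ioo_countable_iff.1 (hc.mono hne)).not_gt hε
  have h : Metric.ball y r = Metric.closedBall y r := by
    ext z
    simp only [Metric.mem_ball, Metric.mem_closedBall]
    exact ⟨le_of_lt, fun hz => lt_of_le_of_ne hz fun h => hr' ⟨z, h⟩⟩
  refine ⟨Metric.ball y r, ⟨?_, Metric.isOpen_ball⟩, Metric.mem_ball_self hr.1,
    (Metric.ball_subset_ball hr.2.le).trans hεU⟩
  rw [h]
  exact Metric.isClosed_closedBall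

namespace ClosedDiscreteImages

theorem of_surjective {M N : Type u} [Semigroup M] [Semigroup N] (hM : ClosedDiscreteImages M)
    (f : M →ₙ* N) (hf : Function.Surjective f) : ClosedDiscreteImages N := by
  intro Y _ _ _ _ hY h
  have := hM Y hY (h.comp f)
  rwa [MulHom.coe_comp, hf.range_comp] at this

/-- Finitely-valued homomorphisms have jointly finitely many values. -/
theorem finite_range_pi {M : Type u} [Semigroup M] (hM : ClosedDiscreteImages M) {ι : Type u}
    {S : Type} [Semigroup S] (h : ι → M →ₙ* S) (hh : ∀ i, (Set.range (h i)).Finite) :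
    (Set.range fun (x : M) (i : ι) => h i x).Finite := by
  let (i : ι) : TopologicalSpace (h i).srange := ⊥
  have (i : ι) : DiscreteTopology (h i).srange := ⟨rfl⟩
  have (i : ι) : Finite (h i).srange := (hh i).to_subtype
  let Φ : M →ₙ* ∀ i, (h i).srange := MulHom.pi fun i => (h i).srangeRestrict
  have key := hM (∀ i, (h i).srange) (.of_profinite _) Φ
  have hfin : (Set.range Φ).Finite := key.1.isCompact.finite key.2
  refine (hfin.image fun (f : ∀ i, (h i).srange) (i : ι) => (f i : S)).subset ?_
  rintro _ ⟨x, rfl⟩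
  exact ⟨Φ x, ⟨x, rfl⟩, rfl⟩

theorem finite_range_circle {M : Type u} [Monoid M] (hM : ClosedDiscreteImages M)
    (ψ : M →* Circle) (hc : (Set.range ψ).Countable) (ht : ∀ x, IsOfFinOrder (ψ x)) :
    (Set.range ψ).Finite := by
  let R : Subgroup Circle :=
    { MonoidHom.mrange ψ with
      inv_mem' := by
        rintro _ ⟨x, rfl⟩
        have h := (ht x).mem_powers_iff_mem_zpowers.2
          (Subgroup.inv_mem _ (Subgroup.mem_zpowers (ψ x)))
        obtain ⟨n, hn⟩ := h
        exact ⟨x ^ n, by simpa using hn⟩ }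
  have hR : (R : Set Circle) = Set.range ψ := rfl
  have : Countable R := hc.to_subtype
  let φ : M →ₙ* ULift.{u} R :=
    { toFun := fun x => ⟨⟨ψ x, x, rfl⟩⟩
      map_mul' := fun x y => by ext; simp }
  have hφ : Function.Surjective φ := by
    rintro ⟨⟨_, x, rfl⟩⟩
    exact ⟨x, rfl⟩
  have hind : IsInducing (ULift.down : ULift.{u} R → R) := Homeomorph.ulift.isInducing
  have : T1Space (ULift.{u} R) := Homeomorph.ulift.symm.t1Space
  have : ContinuousMul (ULift.{u} R) :=
    ⟨continuous_uliftUp.comp ((continuous_uliftDown.comp continuous_fst).mul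
      (continuous_uliftDown.comp continuous_snd))⟩
  have key := (hM (ULift.{u} R) (.of_isInducing hind (.of_countable_metric R)) φ).2
  rw [hφ.range_eq, isDiscrete_univ_iff] at key
  have : DiscreteTopology R := Homeomorph.ulift.symm.isEmbedding.discreteTopology
  have hcl : IsClosed (R : Set Circle) := Subgroup.isClosed_of_discrete
  exact hcl.isCompact.finite ⟨inferInstance⟩

end ClosedDiscreteImages

/-- The canonical homomorphism from the rational circle to the real circle. -/
noncomputable def ratToRealAddCircle : AddCircle (1 : ℚ) →+ AddCircle (1 : ℝ) :=
  QuotientAddGroup.map _ _ (Rat.castHom ℝ).toAddMonoidHom <| by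
    rw [AddSubgroup.zmultiples_le]
    exact ⟨1, by simp⟩

theorem ratToRealAddCircle_injective : Function.Injective ratToRealAddCircle := by
  rw [injective_iff_map_eq_zero]
  intro a
  induction a using QuotientAddGroup.induction_on with
  | H q =>
    intro h
    have h' : ((q : ℝ) : AddCircle (1 : ℝ)) = 0 := h
    rw [AddCircle.coe_eq_zero_iff] at h'
    obtain ⟨n, hn⟩ := h'
    refine (AddCircle.coe_eq_zero_iff (1 : ℚ)).2 ⟨n, ?_⟩
    have : ((n : ℚ) : ℝ) = (q : ℝ) := by simpa using hn
    simpa using (Rat.cast_injective this)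

theorem isOfFinAddOrder_ratAddCircle (a : AddCircle (1 : ℚ)) : IsOfFinAddOrder a := by
  have : Fact ((0 : ℚ) < 1) := ⟨one_pos⟩
  induction a using QuotientAddGroup.induction_on with
  | H q => exact AddCircle.isOfFinAddOrder_iff_exists_rat_eq_div.2 ⟨q, by simp⟩

theorem exists_torsion_circle_character {G : Type u} [CommGroup G] {g : G} (hg : g ≠ 1) :
    ∃ χ : G →* Circle, (Set.range χ).Countable ∧ (∀ x, IsOfFinOrder (χ x)) ∧ χ g ≠ 1 := by
  obtain ⟨c, hc⟩ := CharacterModule.exists_character_apply_ne_zero_of_ne_zero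
    (A := Additive G) (a := Additive.ofMul g) (by simpa using hg)
  let τ : Multiplicative (AddCircle (1 : ℚ)) →* Circle := MonoidHom.mk'
    (fun a => AddCircle.toCircle (ratToRealAddCircle a.toAdd))
    (fun a b => by simp [AddCircle.toCircle_add])
  have : Countable (Multiplicative (AddCircle (1 : ℚ))) := QuotientAddGroup.mk_surjective.countable
  have hτ : Function.Injective τ := fun a b hab =>
    ratToRealAddCircle_injective (AddCircle.injective_toCircle one_ne_zero hab)
  refine ⟨τ.comp (AddMonoidHom.toMultiplicativeRight c), ?_, fun x => ?_, fun h => ?_⟩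
  · exact (countable_range τ).mono (by rintro _ ⟨x, rfl⟩; exact ⟨_, rfl⟩)
  · exact τ.isOfFinOrder (isOfFinOrder_ofAdd_iff.2 (isOfFinAddOrder_ratAddCircle _))
  · rw [← map_one τ] at h
    exact hc (hτ h)

theorem ClosedDiscreteImages.finite_range_commGroup {M G : Type u} [Monoid M] [CommGroup G]
    (hM : ClosedDiscreteImages M) (h : M →* G) : (Set.range h).Finite := by
  let ι := {χ : G →* Circle // (Set.range χ).Countable ∧ ∀ x, IsOfFinOrder (χ x)}
  have H := hM.finite_range_pi (ι := ι) (fun χ => ((χ.1.comp h : M →* Circle) : M →ₙ* Circle))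
    fun χ => hM.finite_range_circle (χ.1.comp h)
      (χ.2.1.mono (by rintro _ ⟨x, rfl⟩; exact ⟨_, rfl⟩)) fun x => χ.2.2 _
  have hinj : Function.Injective fun (g : G) (χ : ι) => χ.1 g := by
    intro a b hab
    by_contra hne
    obtain ⟨χ, h₁, h₂, h₃⟩ := exists_torsion_circle_character (g := a / b)
      (by rwa [Ne, div_eq_one])
    refine h₃ ?_
    rw [map_div, div_eq_one]
    exact congrFun hab ⟨χ, h₁, h₂⟩
  refine Set.Finite.of_finite_image (f := fun (g : G) (χ : ι) => χ.1 g) ?_ hinj.injOn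
  rw [← Set.range_comp]
  exact H

namespace ClosedDiscreteImages

theorem withOne {X : Type u} [Semigroup X] (hX : ClosedDiscreteImages X) :
    ClosedDiscreteImages (WithOne X) := by
  intro Y _ _ _ _ hY h
  have key := hX Y hY (h.comp WithOne.coeMulHom)
  rw [isClosed_and_discrete_iff] at key ⊢
  have hr : Set.range h = insert (h 1) (Set.range (h.comp WithOne.coeMulHom)) := by
    ext y
    constructor
    · rintro ⟨x, rfl⟩
      induction x with
      | one => exact Or.inl rfl
      | coe x => exact Or.inr ⟨x, rfl⟩
    · rintro (rfl | ⟨x, rfl⟩)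
      exacts [⟨1, rfl⟩, ⟨x, rfl⟩]
  intro y
  rw [hr, insert_eq, ← sup_principal, disjoint_sup_right]
  refine ⟨?_, key y⟩
  have := (isClosed_and_discrete_iff.1
    ⟨isClosed_singleton (x := h 1), subsingleton_singleton.isDiscrete⟩) y
  exact this

/-- Closed discreteness of images passes to submonoids whose complement is a prime ideal. -/
theorem of_mul_mem_iff {M : Type u} [CommMonoid M] (hM : ClosedDiscreteImages M)
    (F : Submonoid M) (hF : ∀ x y, x * y ∈ F ↔ x ∈ F ∧ y ∈ F) : ClosedDiscreteImages F := by
  classical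
  intro Y _ _ _ _ hY h
  let _ : TopologicalSpace (WithZero Y) := .coinduced (fun y : Y => (y : WithZero Y)) inferInstance
  have hopen (U : Set (WithZero Y)) : IsOpen U ↔ IsOpen ((fun y : Y => (y : WithZero Y)) ⁻¹' U) :=
    isOpen_coinduced
  have hcont : Continuous (fun y : Y => (y : WithZero Y)) := continuous_coinduced_rng
  have hinj : Function.Injective (fun y : Y => (y : WithZero Y)) := WithZero.coe_injective
  have hmap : IsOpenMap (fun y : Y => (y : WithZero Y)) := fun U hU => by
    rw [hopen, preimage_image_eq U hinj]
    exact hU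
  have hzero : IsOpen ({0} : Set (WithZero Y)) := by
    rw [hopen]
    convert isOpen_empty
    ext y
    simp
  have hemb : IsOpenEmbedding (fun y : Y => (y : WithZero Y)) :=
    .of_continuous_injective_isOpenMap hcont hinj hmap
  have : T1Space (WithZero Y) := ⟨fun a => by
    rw [← isOpen_compl_iff, hopen, preimage_compl, isOpen_compl_iff]
    exact (subsingleton_singleton.preimage hinj).isClosed⟩
  have : ContinuousMul (WithZero Y) := ⟨continuous_iff_continuousAt.2 fun ⟨a, b⟩ => by
    have hz : 𝓝 (0 : WithZero Y) = pure 0 := (isOpen_singleton_iff_nhds_eq_pure _).1 hzero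
    induction a with
    | zero =>
      simp only [ContinuousAt, nhds_prod_eq, hz, zero_mul]
      refine (tendsto_pure.2 ?_)
      rw [pure_prod, eventually_map]
      exact .of_forall fun b => zero_mul b
    | coe a =>
      induction b with
      | zero =>
        simp only [ContinuousAt, nhds_prod_eq, hz, mul_zero]
        refine (tendsto_pure.2 ?_)
        rw [prod_pure, eventually_map]
        exact .of_forall fun b => mul_zero b
      | coe b =>
        rw [ContinuousAt, nhds_prod_eq, ← hemb.map_nhds_eq, ← hemb.map_nhds_eq,
          prod_map_map_eq, tendsto_map'_iff, ← nhds_prod_eq]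
        exact (hcont.comp continuous_mul).tendsto (a, b)⟩
  have hbase : HasClopenBasis (WithZero Y) := by
    refine .of_forall_exists fun a U ha hU => ?_
    induction a with
    | zero =>
      exact ⟨{0}, ⟨isClosed_singleton, hzero⟩, rfl, singleton_subset_iff.2 ha⟩
    | coe a =>
      obtain ⟨V, hV, haV, hVU⟩ := hY.exists_isClopen (y := a) ha (hU.preimage hcont)
      refine ⟨(fun y : Y => (y : WithZero Y)) '' V, ⟨?_, hmap V hV.isOpen⟩, ⟨a, haV, rfl⟩,
        image_subset_iff.2 hVU⟩
      rw [← isOpen_compl_iff, hopen, preimage_compl, preimage_image_eq V hinj]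
      exact hV.compl.isOpen
  let H : M →ₙ* WithZero Y :=
    { toFun := fun x => if hx : x ∈ F then (h ⟨x, hx⟩ : WithZero Y) else 0
      map_mul' := fun x y => by
        by_cases hx : x ∈ F
        · by_cases hy : y ∈ F
          · rw [dif_pos hx, dif_pos hy, dif_pos ((hF x y).2 ⟨hx, hy⟩), ← WithZero.coe_mul,
              ← map_mul]
            rfl
          · rw [dif_neg hy, mul_zero, dif_neg fun hxy => hy ((hF x y).1 hxy).2]
        · rw [dif_neg hx, zero_mul, dif_neg fun hxy => hx ((hF x y).1 hxy).1] }
  have hpre : (fun y : Y => (y : WithZero Y)) ⁻¹' Set.range H = Set.range h := by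
    ext y
    constructor
    · rintro ⟨x, hx⟩
      by_cases hxF : x ∈ F
      · exact ⟨⟨x, hxF⟩, hinj (by simpa [H, hxF] using hx)⟩
      · simp [H, hxF] at hx
    · rintro ⟨x, rfl⟩
      exact ⟨x, by simp [H]⟩
  obtain ⟨hc, hd⟩ := hM (WithZero Y) hbase H
  rw [← hpre]
  exact ⟨hc.preimage hcont, hd.preimage hcont.continuousOn hinj⟩

attribute [local instance] Ultrafilter.semigroup

theorem _root_.Ultrafilter.mul_pure_comm {Q : Type*} [CommSemigroup Q] (U : Ultrafilter Q) (x : Q) :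
    U * pure x = pure x * U := by
  refine Ultrafilter.coe_injective (Filter.ext fun s => ?_)
  have h₁ := Ultrafilter.eventually_mul U (pure x) (· ∈ s)
  have h₂ := Ultrafilter.eventually_mul (pure x) U (· ∈ s)
  simp only [Ultrafilter.coe_pure, eventually_pure] at h₁ h₂
  refine h₁.trans (Iff.trans ?_ h₂.symm)
  simp only [mul_comm]

theorem _root_.Ultrafilter.pure_mul_pure {Q : Type*} [Semigroup Q] (x y : Q) :
    (pure x * pure y : Ultrafilter Q) = pure (x * y) := by
  refine Ultrafilter.coe_injective (Filter.ext fun s => ?_)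
  have h₁ := Ultrafilter.eventually_mul (pure x) (pure y) (· ∈ s)
  simp only [Ultrafilter.coe_pure, eventually_pure] at h₁
  exact h₁

theorem _root_.Ultrafilter.continuous_pure_mul {Q : Type*} [Semigroup Q] (x : Q) :
    Continuous fun U : Ultrafilter Q => pure x * U := by
  refine ultrafilterBasis_is_basis.continuous_iff.2 ?_
  rintro _ ⟨s, rfl⟩
  convert ultrafilter_isOpen_basic ((fun y => x * y) ⁻¹' s) using 1
  ext U
  have h₂ := Ultrafilter.eventually_mul (pure x) U (· ∈ s)
  simp only [Ultrafilter.coe_pure, eventually_pure] at h₂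
  exact h₂

theorem _root_.Ultrafilter.mul_eq_pure {Q : Type*} [Semigroup Q] {U V : Ultrafilter Q} {s t : Set Q}
    {z : Q} (hs : s ∈ U) (ht : t ∈ V) (h : ∀ a ∈ s, ∀ b ∈ t, a * b = z) : U * V = pure z := by
  have hz : {z} ∈ U * V := (Ultrafilter.eventually_mul U V (· ∈ ({z} : Set Q))).2
    (mem_of_superset hs fun a ha => mem_of_superset ht fun b hb => h a ha b hb)
  obtain ⟨_, rfl, e⟩ := Ultrafilter.eq_pure_of_finite_mem (finite_singleton z) hz
  exact e

theorem finite_of_mul_eq {Q : Type u} [CommMonoid Q] (hQ : ClosedDiscreteImages Q) {z : Q}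
    (hz : ∀ x, x * z = z) {A : Set Q} (hA : ∀ a ∈ A, ∀ b ∈ A, a * b = z) : A.Finite := by
  by_contra hinf
  have : (cofinite ⊓ 𝓟 A).NeBot := Set.Infinite.cofinite_inf_principal_neBot hinf
  let p : Ultrafilter Q := .of (cofinite ⊓ 𝓟 A)
  have hp : (p : Filter Q) ≤ cofinite ⊓ 𝓟 A := Ultrafilter.of_le _
  have hpA : A ∈ p := le_principal_iff.1 (hp.trans inf_le_right)
  have hpc : ∀ x, p ≠ pure x := fun x hx => by
    have : ({x}ᶜ : Set Q) ∈ p := (hp.trans inf_le_left) (finite_singleton x).compl_mem_cofinite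
    rw [hx] at this
    exact Ultrafilter.mem_pure.1 this rfl
  have hmem (x : Q) : (fun a => x * a) '' A ∈ pure x * p := by
    refine (Ultrafilter.eventually_mul (pure x) p (· ∈ (fun a => x * a) '' A)).2 ?_
    rw [Ultrafilter.coe_pure, eventually_pure]
    exact mem_of_superset hpA fun a ha => ⟨a, ha, rfl⟩
  have hmul (x y : Q) : ∀ a ∈ (fun a => x * a) '' A, ∀ b ∈ (fun a => y * a) '' A, a * b = z := by
    rintro _ ⟨a, ha, rfl⟩ _ ⟨b, hb, rfl⟩
    show x * a * (y * b) = z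
    rw [mul_mul_mul_comm, hA a ha b hb, hz]
  let S : Subsemigroup (Ultrafilter Q) :=
    { carrier := {U | (∃ x, U = pure x) ∨ ∃ x, U = pure x * p}
      mul_mem' := by
        rintro _ _ (⟨x, rfl⟩ | ⟨x, rfl⟩) (⟨y, rfl⟩ | ⟨y, rfl⟩)
        · exact Or.inl ⟨_, Ultrafilter.pure_mul_pure x y⟩
        · exact Or.inr ⟨x * y, by rw [← mul_assoc, Ultrafilter.pure_mul_pure]⟩
        · exact Or.inr ⟨y * x, by
            rw [Ultrafilter.mul_pure_comm, ← mul_assoc, Ultrafilter.pure_mul_pure]⟩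
        · exact Or.inl ⟨z, Ultrafilter.mul_eq_pure (hmem x) (hmem y) (hmul x y)⟩ }
  have hpure (x : Q) : 𝓝 (pure x : Ultrafilter Q) = pure (pure x) := by
    refine (isOpen_singleton_iff_nhds_eq_pure _).1 ?_
    convert ultrafilter_isOpen_basic ({x} : Set Q) using 1
    ext U
    refine ⟨fun h => by rw [mem_singleton_iff.1 h]; exact rfl, fun h => ?_⟩
    obtain ⟨_, rfl, e⟩ := Ultrafilter.eq_pure_of_finite_mem (finite_singleton x) h
    exact mem_singleton_iff.2 e
  have : ContinuousMul S := ⟨by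
    rw [IsInducing.subtypeVal.continuous_iff, continuous_iff_continuousAt]
    suffices H : ∀ U V : S, ContinuousAt (fun q : Ultrafilter Q × Ultrafilter Q => q.1 * q.2)
        ((U : Ultrafilter Q), (V : Ultrafilter Q)) by
      rintro ⟨U, V⟩
      exact ContinuousAt.comp (f := fun q : S × S => ((q.1 : Ultrafilter Q), (q.2 : Ultrafilter Q)))
        (x := (U, V)) (H U V) (continuous_subtype_val.prodMap continuous_subtype_val).continuousAt
    rintro ⟨U, hU⟩ ⟨V, hV⟩
    rcases hU with ⟨x, rfl⟩ | ⟨x, rfl⟩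
    · rw [ContinuousAt, nhds_prod_eq, hpure, pure_prod, tendsto_map'_iff]
      exact (Ultrafilter.continuous_pure_mul x).tendsto V
    · rcases hV with ⟨y, rfl⟩ | ⟨y, rfl⟩
      · rw [ContinuousAt, nhds_prod_eq, hpure, prod_pure, tendsto_map'_iff]
        have := (Ultrafilter.continuous_pure_mul y).tendsto (pure x * p)
        simp only [← Ultrafilter.mul_pure_comm _ y] at this
        exact this
      · refine tendsto_nhds_of_eventually_eq ?_
        simp only [Ultrafilter.mul_eq_pure (hmem x) (hmem y) (hmul x y), nhds_prod_eq]
        filter_upwards [prod_mem_prod ((ultrafilter_isOpen_basic _).mem_nhds (hmem x))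
          ((ultrafilter_isOpen_basic _).mem_nhds (hmem y))] with q hq
        exact Ultrafilter.mul_eq_pure hq.1 hq.2 (hmul x y)⟩
  let h : Q →ₙ* S :=
    { toFun := fun x => ⟨pure x, Or.inl ⟨x, rfl⟩⟩
      map_mul' := fun x y => Subtype.ext (Ultrafilter.pure_mul_pure x y).symm }
  have hcl := (hQ S (.of_isInducing .subtypeVal (.of_profinite _)) h).1
  obtain ⟨O, hO, hOh⟩ := isOpen_induced_iff.1 hcl.isOpen_compl
  have hone : (pure 1 * p : Ultrafilter Q) = p := by
    refine Ultrafilter.coe_injective (Filter.ext fun s => ?_)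
    have h₂ := Ultrafilter.eventually_mul (pure 1) p (· ∈ s)
    simp only [Ultrafilter.coe_pure, eventually_pure, one_mul] at h₂
    exact h₂
  have hpO : p ∈ O := by
    refine (Set.ext_iff.1 hOh ⟨p, Or.inr ⟨1, hone.symm⟩⟩).2 ?_
    rintro ⟨x, hx⟩
    exact hpc x (Subtype.ext_iff.1 hx).symm
  obtain ⟨x, hx⟩ := denseRange_pure.exists_mem_open hO ⟨p, hpO⟩
  exact (Set.ext_iff.1 hOh (h x)).1 hx ⟨x, rfl⟩

end ClosedDiscreteImages

/-- The elements of a commutative monoid some power of which is divisible by any given element. -/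
def archimedeanKernel (M : Type*) [CommMonoid M] : Set M := {x | ∀ y, ∃ n : ℕ, y ∣ x ^ n}

theorem mul_mem_archimedeanKernel {M : Type*} [CommMonoid M] {x : M}
    (hx : x ∈ archimedeanKernel M) (y : M) : x * y ∈ archimedeanKernel M := fun z => by
  obtain ⟨n, hn⟩ := hx z
  exact ⟨n, by rw [mul_pow]; exact hn.mul_right _⟩

theorem isIdealSet_of_mul_mem {M : Type*} [CommMonoid M] {I : Set M}
    (h : ∀ x ∈ I, ∀ y, x * y ∈ I) : IsIdealSet M I :=
  fun x hx y => ⟨h x hx y, mul_comm x y ▸ h x hx y⟩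

theorem isIdealSet_multiples {M : Type*} [CommMonoid M] (x : M) : IsIdealSet M {y | x ∣ y} :=
  isIdealSet_of_mul_mem fun _ h y => Dvd.dvd.mul_right h y

theorem exists_idempotent_pow {M : Type*} [Monoid M] {x : M} {a d : ℕ} (hd : 0 < d)
    (h : x ^ (a + d) = x ^ a) : ∃ N, 0 < N ∧ x ^ N * x ^ N = x ^ N := by
  have step (j b : ℕ) (hb : a ≤ b) : x ^ (b + j * d) = x ^ b := by
    induction j with
    | zero => simp
    | succ j ih =>
      obtain ⟨c, rfl⟩ := Nat.exists_eq_add_of_le hb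
      rw [← ih, show a + c + (j + 1) * d = (a + d) + (c + j * d) by ring, pow_add, h, ← pow_add,
        add_assoc]
  refine ⟨(a + 1) * d, by positivity, ?_⟩
  rw [← pow_add]
  exact step (a + 1) ((a + 1) * d) (by nlinarith)

namespace ClosedDiscreteImages

variable {M : Type u} [CommMonoid M]

/-- If the products of elements of `A` lie in an ideal `J`, then almost all of `A` does. -/
theorem finite_sdiff_of_mul_mem (hM : ClosedDiscreteImages M) {J : Set M} (hJ : IsIdealSet M J)
    (hne : J.Nonempty) {A : Set M} (hA : ∀ a ∈ A, ∀ b ∈ A, a * b ∈ J) : (A \ J).Finite := by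
  obtain ⟨j, hj⟩ := hne
  let c := ReesCon J hJ
  have hQ : ClosedDiscreteImages c.Quotient :=
    hM.of_surjective (c.mk' : M →ₙ* c.Quotient) c.mk'_surjective
  have hfin : (c.mk' '' A).Finite := by
    refine hQ.finite_of_mul_eq (z := c.mk' j) (fun q => ?_) ?_
    · obtain ⟨x, rfl⟩ := c.mk'_surjective q
      rw [← map_mul]
      exact (Con.eq c).2 (Or.inr ⟨(hJ j hj x).2, hj⟩)
    · rintro _ ⟨a, ha, rfl⟩ _ ⟨b, hb, rfl⟩
      rw [← map_mul]
      exact (Con.eq c).2 (Or.inr ⟨hA a ha b hb, hj⟩)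
  refine (hfin.subset (image_mono sdiff_subset)).of_finite_image fun a ha b _ hab => ?_
  exact ((Con.eq c).1 hab).resolve_right fun h => ha.2 h.1

/-- Elements of the kernel have equal images in a finite group of fractions. -/
theorem exists_finite_localization (hM : ClosedDiscreteImages M) {x : M}
    (hx : x ∈ archimedeanKernel M) :
    ∃ (G : Type u) (f : M → G), (Set.range f).Finite ∧
      ∀ y z, f y = f z → ∃ n : ℕ, x ^ n * y = x ^ n * z := by
  let S := Submonoid.powers x
  let f : M →* Localization S := (Localization.monoidOf S : M →* Localization S)
  have hf : ∀ y, IsUnit (f y) := fun y => by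
    obtain ⟨n, hn⟩ := hx y
    exact isUnit_of_dvd_unit (map_dvd f hn) ((Localization.monoidOf S).map_units ⟨x ^ n, n, rfl⟩)
  refine ⟨_, IsUnit.liftRight f hf, hM.finite_range_commGroup _, fun y z hyz => ?_⟩
  have h : f y = f z := congrArg Units.val hyz
  obtain ⟨⟨_, n, rfl⟩, hn⟩ := (Localization.monoidOf S).eq_iff_exists.1 h
  exact ⟨n, hn⟩

theorem exists_idempotent_dvd (hM : ClosedDiscreteImages M) {x : M}
    (hx : x ∈ archimedeanKernel M) : ∃ e : M, e * e = e ∧ ∀ y, y ∣ e := by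
  obtain ⟨G, f, hfin, hf⟩ := hM.exists_finite_localization hx
  obtain ⟨m, n, hmn, h⟩ : ∃ m n : ℕ, m < n ∧ f (x ^ m) = f (x ^ n) := by
    have := hfin.to_subtype
    obtain ⟨m, n, hne, h⟩ := Finite.exists_ne_map_eq_of_infinite
      fun n : ℕ => (⟨f (x ^ n), x ^ n, rfl⟩ : Set.range f)
    have h' : f (x ^ m) = f (x ^ n) := Subtype.ext_iff.1 h
    rcases hne.lt_or_gt with hlt | hlt
    exacts [⟨m, n, hlt, h'⟩, ⟨n, m, hlt, h'.symm⟩]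
  obtain ⟨k, hk⟩ := hf _ _ h
  obtain ⟨N, hN, he⟩ := exists_idempotent_pow (x := x) (a := k + m) (d := n - m) (by omega) (by
    rw [pow_add x k m, hk, ← pow_add]
    congr 1
    omega)
  refine ⟨x ^ N, he, fun y => ?_⟩
  obtain ⟨n, hn⟩ := hx y
  refine hn.trans ?_
  have hidem : IsIdempotentElem (x ^ N) := he
  rw [← hidem.pow_succ_eq n, ← pow_mul]
  exact pow_dvd_pow x (by nlinarith)

theorem finite_multiples_of_idempotent (hM : ClosedDiscreteImages M) {e : M} (he : e * e = e)
    (hd : ∀ y, y ∣ e) : {y | e ∣ y}.Finite := by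
  obtain ⟨G, f, hfin, hf⟩ := hM.exists_finite_localization (x := e) fun y => ⟨1, by simpa using hd y⟩
  have key : ∀ y z, f y = f z → e * y = e * z := fun y z h => by
    obtain ⟨n, hn⟩ := hf y z h
    have hidem : IsIdempotentElem e := he
    have := congrArg (e * ·) hn
    simpa only [← mul_assoc, ← pow_succ', hidem.pow_succ_eq] using this
  have hfac : Function.FactorsThrough (e * ·) f := fun y z h => key y z h
  have : (Set.range (e * ·)).Finite := by
    have h := hfin.image (Function.extend f (e * ·) fun _ => e)
    rw [← Set.range_comp] at h
    convert h using 2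
    ext y
    exact (hfac.extend_apply _ y).symm
  refine this.subset ?_
  rintro _ ⟨z, rfl⟩
  exact ⟨z, rfl⟩

theorem finite_multiples (hM : ClosedDiscreteImages M) {e : M} (he : {y | e ∣ y}.Finite) {x : M}
    (hx : ∃ n : ℕ, e ∣ x ^ n) : {y | x ∣ y}.Finite := by
  have key : ∀ n : ℕ, {y | x ^ (n + 1) ∣ y}.Finite → {y | x ∣ y}.Finite := by
    intro n
    induction n with
    | zero => simp
    | succ n ih =>
      refine fun h => ih ?_
      refine (h.union (hM.finite_sdiff_of_mul_mem (isIdealSet_multiples (x ^ (n + 1 + 1)))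
        ⟨_, dvd_refl _⟩ (A := {y | x ^ (n + 1) ∣ y}) fun a ha b hb => ?_)).subset ?_
      · refine (pow_dvd_pow x (show n + 1 + 1 ≤ (n + 1) + (n + 1) by omega)).trans ?_
        rw [pow_add]
        exact mul_dvd_mul ha hb
      · intro y hy
        by_cases h' : x ^ (n + 1 + 1) ∣ y
        exacts [Or.inl h', Or.inr ⟨hy, h'⟩]
  obtain ⟨n, hn⟩ := hx
  refine key n (he.subset fun y hy => ?_)
  exact hn.trans ((pow_dvd_pow x n.le_succ).trans hy)

theorem finite_archimedeanKernel (hM : ClosedDiscreteImages M) :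
    (archimedeanKernel M).Finite := by
  set K := archimedeanKernel M
  rcases K.eq_empty_or_nonempty with hK | ⟨x₀, hx₀⟩
  · rw [hK]
    exact finite_empty
  obtain ⟨e, he, hed⟩ := hM.exists_idempotent_dvd hx₀
  have hJ₀ := hM.finite_multiples_of_idempotent he hed
  have hdown : ∀ x ∈ K, {y | x ∣ y}.Finite := fun x hx => hM.finite_multiples hJ₀ (hx e)
  let K₂ : Set M := {x | ∃ a ∈ K, ∃ b ∈ K, a * b = x}
  have hK₂ : IsIdealSet M K₂ := isIdealSet_of_mul_mem <| by
    rintro _ ⟨a, ha, b, hb, rfl⟩ y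
    exact ⟨a, ha, b * y, mul_mem_archimedeanKernel hb y, (mul_assoc a b y).symm⟩
  have hF : (K \ K₂).Finite := hM.finite_sdiff_of_mul_mem hK₂ ⟨_, x₀, hx₀, x₀, hx₀, rfl⟩
    fun a ha b hb => ⟨a, ha, b, hb, rfl⟩
  let J : Set M := {y | e ∣ y} ∪ ⋃ f ∈ K \ K₂, {y | f ∣ y}
  have hJ : J.Finite := hJ₀.union (hF.biUnion fun f hf => hdown f hf.1)
  have hJmul : ∀ x ∈ J, ∀ y, x * y ∈ J := by
    rintro x (hx | hx) y
    · exact Or.inl (Dvd.dvd.mul_right hx y)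
    · obtain ⟨f, hf, hfx⟩ := mem_iUnion₂.1 hx
      exact Or.inr (mem_iUnion₂.2 ⟨f, hf, Dvd.dvd.mul_right hfx y⟩)
  have hKJ : ∀ x ∈ K, ∀ k ∈ K, k * x ∈ J := by
    intro x hx
    by_contra! hne
    let T : Set M := {y | (∃ k ∈ K, k * x = y) ∧ y ∉ J}
    have hT : T.Finite := (hdown x hx).subset <| by
      rintro _ ⟨⟨k, _, rfl⟩, _⟩
      exact Dvd.intro_left k rfl
    have hTne : T.Nonempty := by
      obtain ⟨k, hk, h⟩ := hne
      exact ⟨_, ⟨k, hk, rfl⟩, h⟩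
    obtain ⟨y, ⟨⟨k, hk, rfl⟩, hyJ⟩, hmax⟩ := hT.exists_maximalFor
      (fun y => {z | y ∣ z}.ncard) T hTne
    have hk₂ : k ∈ K₂ := by
      by_contra hk₂
      exact hyJ (hJmul k (Or.inr (mem_iUnion₂.2 ⟨k, ⟨hk, hk₂⟩, dvd_refl k⟩)) x)
    obtain ⟨a, ha, b, hb, rfl⟩ := hk₂
    have hab : a * b * x = b * x * a := by rw [mul_assoc, mul_comm]
    have hbJ : b * x ∉ J := fun h => hyJ (hab ▸ hJmul _ h a)
    have hsub : {z | a * b * x ∣ z} ⊆ {z | b * x ∣ z} := fun z hz =>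
      (Dvd.intro a hab.symm).trans hz
    have hfin : {z | b * x ∣ z}.Finite := hdown _ (mul_mem_archimedeanKernel hb x)
    have heq := Set.eq_of_subset_of_ncard_le hsub
      (hmax ⟨⟨b, hb, rfl⟩, hbJ⟩ (ncard_le_ncard hsub hfin)) hfin
    obtain ⟨u, hu⟩ : a * b * x ∣ b * x := heq.ge (dvd_refl (b * x))
    have hu' : b * x = b * x * (a * u) := by
      rw [← mul_assoc, ← hab]
      exact hu
    have hpow : ∀ n : ℕ, b * x = b * x * (a * u) ^ n := by
      intro n
      induction n with
      | zero => simp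
      | succ n ih => rw [pow_succ, ← mul_assoc, ← ih, ← hu']
    obtain ⟨n, hn⟩ := mul_mem_archimedeanKernel ha u e
    refine hbJ (Or.inl ?_)
    show e ∣ b * x
    rw [hpow n]
    exact hn.mul_left _
  refine (hF.union hJ).subset fun x hx => ?_
  by_cases hx₂ : x ∈ K₂
  · obtain ⟨a, ha, b, hb, rfl⟩ := hx₂
    exact Or.inr (hKJ b hb a ha)
  · exact Or.inl ⟨hx, hx₂⟩

/-- The submonoid of divisors of powers of `x`. -/
def _root_.divisorsOfPowers (x : M) : Submonoid M where
  carrier := {y | ∃ n : ℕ, y ∣ x ^ n}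
  one_mem' := ⟨0, one_dvd _⟩
  mul_mem' := by
    rintro a b ⟨m, hm⟩ ⟨n, hn⟩
    exact ⟨m + n, by rw [pow_add]; exact mul_dvd_mul hm hn⟩

theorem _root_.mul_mem_divisorsOfPowers_iff {x a b : M} :
    a * b ∈ divisorsOfPowers x ↔ a ∈ divisorsOfPowers x ∧ b ∈ divisorsOfPowers x := by
  refine ⟨?_, fun h => mul_mem h.1 h.2⟩
  rintro ⟨n, hn⟩
  exact ⟨⟨n, (dvd_mul_right a b).trans hn⟩, ⟨n, (dvd_mul_left b a).trans hn⟩⟩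

theorem _root_.mem_divisorsOfPowers_self (x : M) : x ∈ divisorsOfPowers x := ⟨1, by simp⟩

theorem finite_of_commMonoid (hM : ClosedDiscreteImages M) : Finite M := by
  classical
  let σ (x : M) : M →ₙ* Fin 2 :=
    { toFun := fun y => if y ∈ divisorsOfPowers x then 1 else 0
      map_mul' := fun a b => by
        by_cases ha : a ∈ divisorsOfPowers x <;> by_cases hb : b ∈ divisorsOfPowers x <;>
          simp [mul_mem_divisorsOfPowers_iff, ha, hb] }
  have hσ : ∀ y z, (fun x => σ x y) = (fun x => σ x z) →
      ∀ x, y ∈ divisorsOfPowers x ↔ z ∈ divisorsOfPowers x := by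
    intro y z h x
    have := congrFun h x
    by_cases hy : y ∈ divisorsOfPowers x <;> by_cases hz : z ∈ divisorsOfPowers x <;>
      simp_all [σ]
  have hfin := hM.finite_range_pi σ fun x => toFinite _
  rw [← Set.finite_univ_iff]
  refine Set.Finite.of_finite_fibers (fun y x => σ x y) (hfin.subset (by simp)) ?_
  rintro _ ⟨y, -, rfl⟩
  have hF := (hM.of_mul_mem_iff (divisorsOfPowers y)
    fun _ _ => mul_mem_divisorsOfPowers_iff).finite_archimedeanKernel
  refine (hF.image Subtype.val).subset ?_
  rintro z ⟨-, hz⟩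
  have hzy := hσ z y hz
  have hz' : z ∈ divisorsOfPowers y := (hzy y).2 (mem_divisorsOfPowers_self y)
  obtain ⟨m, hm⟩ : y ∈ divisorsOfPowers z := (hzy z).1 (mem_divisorsOfPowers_self z)
  refine ⟨⟨z, hz'⟩, ?_, rfl⟩
  rintro ⟨w, n, hn⟩
  obtain ⟨v, hv⟩ : w ∣ z ^ (m * n) := hn.trans (by rw [pow_mul]; exact pow_dvd_pow_of_dvd hm n)
  have hv' : v ∈ divisorsOfPowers y :=
    (mul_mem_divisorsOfPowers_iff.1 (hv ▸ pow_mem hz' (m * n))).2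
  exact ⟨m * n, ⟨v, hv'⟩, Subtype.ext hv⟩

end ClosedDiscreteImages

theorem ClosedDiscreteImages.finite {X : Type u} [CommSemigroup X]
    (hX : ClosedDiscreteImages X) : Finite X := by
  have := hX.withOne.finite_of_commMonoid
  exact Finite.of_injective _ (WithOne.coe_injective (α := X))

theorem closedDiscreteImages_of_projectively {X : Type u} [Semigroup X]
    (hc : ProjectivelyTzSClosed X) (hd : ProjectivelyTzSDiscrete X) : ClosedDiscreteImages X := by
  intro Y _ _ _ _ hY h
  refine ⟨?_, ⟨hd Y hY h⟩⟩
  let g : (Con.ker h).Quotient →ₙ* Y :=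
    { toFun := fun q => Con.liftOn q h fun _ _ hab => hab
      map_mul' := by
        rintro ⟨a⟩ ⟨b⟩
        exact map_mul h a b }
  have hg : Set.range g = Set.range h := by
    ext y
    constructor
    · rintro ⟨⟨x⟩, rfl⟩
      exact ⟨x, rfl⟩
    · rintro ⟨x, rfl⟩
      exact ⟨(x : (Con.ker h).Quotient), rfl⟩
  rw [← hg]
  refine hc (Con.ker h) Y hY g ?_ ?_
  · rintro ⟨a⟩ ⟨b⟩ hab
    exact (Con.eq _).2 hab
  · rw [hg]
    exact hd Y hY h

theorem AbsolutelyT1SClosed.discreteTopology {X : Type u} [Semigroup X]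
    (hX : AbsolutelyT1SClosed X) : ProjectivelyT1SDiscrete X := by
  intro Y _ _ _ _ h
  let Z := h.srange
  show DiscreteTopology Z
  rw [discreteTopology_iff_nhds_ne]
  intro z
  -- Double the point `z`: the extra point `none` multiplies like `z`.
  let π : Option Z → Z := fun o => o.getD z
  let _ : Semigroup (Option Z) :=
    { mul := fun a b => some (π a * π b)
      mul_assoc := fun a b c => congrArg some (mul_assoc (π a) (π b) (π c)) }
  let _ : TopologicalSpace (Option Z) :=
    { IsOpen := fun U => IsOpen (some ⁻¹' U) ∧ (none ∈ U → some ⁻¹' U ∈ 𝓝[≠] z)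
      isOpen_univ := ⟨isOpen_univ, fun _ => univ_mem⟩
      isOpen_inter := fun U V hU hV => ⟨hU.1.inter hV.1, fun h => inter_mem (hU.2 h.1) (hV.2 h.2)⟩
      isOpen_sUnion := fun s hs => by
        refine ⟨?_, ?_⟩
        · rw [preimage_sUnion]
          exact isOpen_biUnion fun U hU => (hs U hU).1
        · rintro ⟨U, hU, h⟩
          exact mem_of_superset ((hs U hU).2 h) (preimage_mono (subset_sUnion_of_mem hU)) }
  have hopen (U : Set (Option Z)) :
      IsOpen U ↔ IsOpen (some ⁻¹' U) ∧ (none ∈ U → some ⁻¹' U ∈ 𝓝[≠] z) := Iff.rfl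
  have hsome : Continuous (some : Z → Option Z) := ⟨fun U hU => ((hopen U).1 hU).1⟩
  have hπ : Continuous π := ⟨fun U hU => (hopen _).2
    ⟨hU, fun h => mem_nhdsWithin_of_mem_nhds (hU.mem_nhds h)⟩⟩
  have : ContinuousMul (Option Z) :=
    ⟨hsome.comp ((hπ.comp continuous_fst).mul (hπ.comp continuous_snd))⟩
  have : T1Space (Option Z) := ⟨fun o => by
    rw [← isOpen_compl_iff, hopen]
    cases o with
    | none =>
      have : (some ⁻¹' {none}ᶜ : Set Z) = Set.univ := by ext; simp
      rw [this]
      exact ⟨isOpen_univ, fun _ => univ_mem⟩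
    | some w =>
      have : (some ⁻¹' {some w}ᶜ : Set Z) = {w}ᶜ := by ext; simp
      rw [this]
      refine ⟨isOpen_compl_singleton, fun _ => ?_⟩
      by_cases hw : w = z
      · rw [hw]
        exact self_mem_nhdsWithin
      · exact mem_nhdsWithin_of_mem_nhds (isOpen_compl_singleton.mem_nhds (Ne.symm hw))⟩
  let g : X →ₙ* Option Z :=
    { toFun := fun x => some (h.srangeRestrict x)
      map_mul' := fun x y => congrArg some (map_mul h.srangeRestrict x y) }
  have hr : (Set.range g)ᶜ = {none} := by
    ext o
    cases o with
    | none =>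
      refine iff_of_true ?_ rfl
      rintro ⟨x, hx⟩
      cases hx
    | some w =>
      obtain ⟨_, x, rfl⟩ := w
      exact iff_of_false (fun hn => hn ⟨x, rfl⟩) (by simp)
  have ho := (hX (Option Z) g).isOpen_compl
  rw [hr, hopen] at ho
  have := ho.2 rfl
  rwa [show (some ⁻¹' {none} : Set Z) = ∅ by ext; simp, empty_mem_iff_bot] at this

theorem Set.Finite.discreteTopology_of_t1 {Y : Type*} [TopologicalSpace Y] [T1Space Y]
    {s : Set Y} (hs : s.Finite) : DiscreteTopology s := by
  have := hs.to_subtype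
  infer_instance

theorem statement0 (X : Type u) [CommSemigroup X] :
    (AbsolutelyT1SClosed X ↔ Finite X) ∧
    ((ProjectivelyT1SClosed X ∧ ProjectivelyT1SDiscrete X) ↔ Finite X) ∧
    ((ProjectivelyTzSClosed X ∧ ProjectivelyTzSDiscrete X) ↔ Finite X) := by
  have hquot (_ : Finite X) (c : Con X) : Finite c.Quotient :=
    Finite.of_surjective (fun x : X => (x : c.Quotient)) Quotient.mk''_surjective
  refine ⟨⟨fun hX => ?_, fun hX Y _ _ _ _ h => (Set.finite_range h).isClosed⟩,
    ⟨fun ⟨hc, hd⟩ => ?_, fun hX => ⟨fun c Y _ _ _ _ h _ _ => ?_, fun Y _ _ _ _ h => ?_⟩⟩,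
    ⟨fun ⟨hc, hd⟩ => (closedDiscreteImages_of_projectively hc hd).finite,
      fun hX => ⟨fun c Y _ _ _ _ _ h _ _ => ?_, fun Y _ _ _ _ _ h => ?_⟩⟩⟩
  · exact ClosedDiscreteImages.finite fun Y _ _ _ _ _ h => ⟨hX Y h, ⟨hX.discreteTopology Y h⟩⟩
  · exact (closedDiscreteImages_of_projectively (fun c Y _ _ _ _ _ h hi hr => hc c Y h hi hr)
      fun Y _ _ _ _ _ h => hd Y h).finite
  · have := hquot hX c
    exact (Set.finite_range h).isClosed
  · exact (Set.finite_range h).discreteTopology_of_t1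
  · have := hquot hX c
    exact (Set.finite_range h).isClosed
  · exact (Set.finite_range h).discreteTopology_of_t1
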